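/- Let {Λ_j} be a sequence of probability measures on the metric space (P₂(ℝᵈ), W₂) such that each Λ_j admits a Wasserstein median ν_j, and suppose W₂(Λ_j, Λ) → 0 as j → ∞ for some Λ ∈ P₂(P₂(ℝᵈ)), where W₂ here denotes the 2-Wasserstein distance on probability measures over the metric space (P₂(ℝᵈ), W₂). Then the sequence {ν_j} has a limit point ν (in the W₂ metric on P₂(ℝᵈ)), and every such limit point is a Wasserstein median of Λ. -/

import Mathlib

open MeasureTheory Filter Set
open scoped ENNReal NNReal

noncomputable section

abbrev Rd (d : ℕ) := EuclideanSpace ℝ (Fin d)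

/-- `π` is a coupling of `μ` and `ν`. -/
def IsCoupling {α : Type*} [MeasurableSpace α] (π : Measure (α × α)) (μ ν : Measure α) : Prop :=
  π.map Prod.fst = μ ∧ π.map Prod.snd = ν

/-- Squared transport cost with ground cost `c`. -/
noncomputable def transportCost2 {α : Type*} [MeasurableSpace α] (c : α → α → ℝ≥0∞)
    (μ ν : Measure α) : ℝ≥0∞ :=
  ⨅ π ∈ {π : Measure (α × α) | IsCoupling π μ ν}, ∫⁻ q, c q.1 q.2 ^ 2 ∂π

/-- 2-Wasserstein distance with ground cost `c`. -/
noncomputable def wasserstein2 {α : Type*} [MeasurableSpace α] (c : α → α → ℝ≥0∞)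
    (μ ν : Measure α) : ℝ≥0∞ :=
  transportCost2 c μ ν ^ (1 / 2 : ℝ)

/-- The 2-Wasserstein distance on a normed measurable space. -/
noncomputable def W2 {α : Type*} [MeasurableSpace α] [EDist α] (μ ν : Measure α) : ℝ≥0∞ :=
  wasserstein2 (fun x y => edist x y) μ ν

/-- `μ ∈ P₂`: a Borel probability measure with finite second moment. -/
def MemP2 {α : Type*} [MeasurableSpace α] [NormedAddCommGroup α] (μ : Measure α) : Prop :=
  IsProbabilityMeasure μ ∧ ∫⁻ x, (‖x‖₊ : ℝ≥0∞) ^ 2 ∂μ < ⊤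
/-- `ν` is a Wasserstein median of the probability measure `Λ` on `P₂(ℝᵈ)`. -/
def IsWassersteinMedian {d : ℕ} (Λ : Measure (Measure (Rd d))) (ν : Measure (Rd d)) : Prop :=
  MemP2 ν ∧ ∀ ξ : Measure (Rd d), MemP2 ξ → (∫⁻ μ, W2 ν μ ∂Λ) ≤ ∫⁻ μ, W2 ξ μ ∂Λ

section Coupling

variable {α : Type*} [MeasurableSpace α]

theorem wasserstein2_le_of_isCoupling {c : α → α → ℝ≥0∞} {μ ν : Measure α}
    {π : Measure (α × α)} (hπ : IsCoupling π μ ν) :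
    wasserstein2 c μ ν ≤ (∫⁻ q, c q.1 q.2 ^ 2 ∂π) ^ (1 / 2 : ℝ) :=
  ENNReal.rpow_le_rpow (iInf₂_le π hπ) (by norm_num)

theorem exists_isCoupling_of_wasserstein2_lt {c : α → α → ℝ≥0∞} {μ ν : Measure α} {r : ℝ≥0∞}
    (h : wasserstein2 c μ ν < r) :
    ∃ π, IsCoupling π μ ν ∧ (∫⁻ q, c q.1 q.2 ^ 2 ∂π) ^ (1 / 2 : ℝ) < r := by
  have h' : transportCost2 c μ ν < r ^ (2 : ℝ) := by
    rw [← ENNReal.rpow_lt_rpow_iff (z := 1 / 2) (by norm_num), ← ENNReal.rpow_mul]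
    simpa [wasserstein2] using h
  simp only [transportCost2, iInf_lt_iff] at h'
  obtain ⟨π, hπ, hlt⟩ := h'
  refine ⟨π, hπ, ?_⟩
  rw [← ENNReal.rpow_lt_rpow_iff (z := 2) (by norm_num), ← ENNReal.rpow_mul]
  simpa using hlt

theorem wasserstein2_comm {c : α → α → ℝ≥0∞} (hc : ∀ x y, c x y = c y x)
    (μ ν : Measure α) : wasserstein2 c μ ν = wasserstein2 c ν μ := by
  suffices H : ∀ μ ν : Measure α, wasserstein2 c μ ν ≤ wasserstein2 c ν μ from
    le_antisymm (H _ _) (H _ _)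
  intro μ ν
  refine le_of_forall_gt fun r hr => ?_
  obtain ⟨π, ⟨h1, h2⟩, hlt⟩ := exists_isCoupling_of_wasserstein2_lt hr
  refine lt_of_le_of_lt (wasserstein2_le_of_isCoupling (π := π.map Prod.swap) ⟨?_, ?_⟩) ?_
  · rw [Measure.map_map measurable_fst measurable_swap]; exact h2
  · rw [Measure.map_map measurable_snd measurable_swap]; exact h1
  · refine lt_of_le_of_lt (ENNReal.rpow_le_rpow (lintegral_map_le _ _) (by norm_num)) ?_
    simpa [hc] using hlt

theorem IsCoupling.isProbabilityMeasure {μ ν : Measure α} {π : Measure (α × α)}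
    (h : IsCoupling π μ ν) [IsProbabilityMeasure μ] : IsProbabilityMeasure π := by
  refine ⟨?_⟩
  rw [← measure_univ (μ := μ), ← h.1, Measure.map_apply measurable_fst .univ, preimage_univ]

theorem IsCoupling.lintegral_fst {μ ν : Measure α} {π : Measure (α × α)}
    (h : IsCoupling π μ ν) {f : α → ℝ≥0∞} (hf : AEMeasurable f μ) :
    ∫⁻ q, f q.1 ∂π = ∫⁻ x, f x ∂μ := by
  rw [← h.1] at hf ⊢
  exact (lintegral_map' hf measurable_fst.aemeasurable).symm

theorem IsCoupling.lintegral_snd {μ ν : Measure α} {π : Measure (α × α)}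
    (h : IsCoupling π μ ν) {f : α → ℝ≥0∞} (hf : AEMeasurable f ν) :
    ∫⁻ q, f q.2 ∂π = ∫⁻ x, f x ∂ν := by
  rw [← h.2] at hf ⊢
  exact (lintegral_map' hf measurable_snd.aemeasurable).symm

theorem lintegral_le_rpow_lintegral_sq {μ : Measure α} [IsProbabilityMeasure μ]
    (f : α → ℝ≥0∞) : ∫⁻ x, f x ∂μ ≤ (∫⁻ x, f x ^ 2 ∂μ) ^ (1 / 2 : ℝ) := by
  obtain ⟨g, hg, hgf, hfg⟩ := exists_measurable_le_lintegral_eq μ f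
  have h := ENNReal.lintegral_mul_le_Lp_mul_Lq μ Real.HolderConjugate.two_two
    hg.aemeasurable (aemeasurable_const (b := (1 : ℝ≥0∞)))
  rw [hfg]
  calc ∫⁻ x, g x ∂μ ≤ (∫⁻ x, g x ^ 2 ∂μ) ^ (1 / 2 : ℝ) := by simpa using h
    _ ≤ _ := by gcongr with x; exact hgf x

end Coupling

section Triangle

open ProbabilityTheory

variable {α : Type*} [MeasurableSpace α]

theorem exists_gluing [StandardBorelSpace α] [Nonempty α] {μ ρ ν : Measure α} [IsFiniteMeasure ρ]
    {π₁ π₂ : Measure (α × α)} (h₁ : IsCoupling π₁ μ ρ) (h₂ : IsCoupling π₂ ρ ν) :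
    ∃ τ : Measure (α × α × α), τ.map (fun q => (q.2.1, q.1)) = π₁ ∧
      τ.map (fun q => (q.1, q.2.2)) = π₂ := by
  have fin_of_map : ∀ {f : α × α → α} {π : Measure (α × α)}, Measurable f → π.map f = ρ →
      IsFiniteMeasure π := fun {f π} hf h => ⟨by
    rw [← preimage_univ (f := f), ← Measure.map_apply hf .univ, h]; exact measure_lt_top _ _⟩
  have := fin_of_map measurable_snd h₁.2
  have := fin_of_map measurable_fst h₂.1
  have e₁ : (π₁.map Prod.swap).fst = ρ := by
    rw [Measure.fst, Measure.map_map measurable_fst measurable_swap]; exact h₁.2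
  have e₂ : π₂.fst = ρ := h₂.1
  have d₁ := Measure.disintegrate (π₁.map Prod.swap) (π₁.map Prod.swap).condKernel
  have d₂ := Measure.disintegrate π₂ π₂.condKernel
  rw [e₁] at d₁
  rw [e₂] at d₂
  refine ⟨ρ ⊗ₘ ((π₁.map Prod.swap).condKernel ×ₖ π₂.condKernel), ?_, ?_⟩
  · have : (ρ ⊗ₘ ((π₁.map Prod.swap).condKernel ×ₖ π₂.condKernel)).map (Prod.map id Prod.fst)
        = π₁.map Prod.swap := by
      rw [← Measure.compProd_map measurable_fst, ← Kernel.fst_eq, Kernel.fst_prod, d₁]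
    have h := congrArg (Measure.map Prod.swap) this
    rw [Measure.map_map measurable_swap (by fun_prop),
      Measure.map_map measurable_swap measurable_swap] at h
    simpa [Function.comp_def, Prod.swap] using h
  · rw [show (fun q : α × α × α => (q.1, q.2.2)) = Prod.map id Prod.snd from rfl,
      ← Measure.compProd_map measurable_snd, ← Kernel.snd_eq, Kernel.snd_prod, d₂]

variable [PseudoEMetricSpace α]

theorem W2_comm (μ ν : Measure α) : W2 μ ν = W2 ν μ :=
  wasserstein2_comm edist_comm μ ν

theorem W2_triangle [OpensMeasurableSpace α] [SecondCountableTopology α] [StandardBorelSpace α]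
    (μ ρ ν : Measure α) [IsProbabilityMeasure ρ] :
    W2 μ ν ≤ W2 μ ρ + W2 ρ ν := by
  have : Nonempty α := nonempty_of_isProbabilityMeasure ρ
  refine ENNReal.le_of_forall_pos_le_add fun ε hε hfin => ?_
  obtain ⟨hf₁, hf₂⟩ := ENNReal.add_lt_top.1 hfin
  have hε' : ((ε / 2 : ℝ≥0) : ℝ≥0∞) ≠ 0 := by positivity
  obtain ⟨π₁, h₁, hl₁⟩ := exists_isCoupling_of_wasserstein2_lt
    (ENNReal.lt_add_right hf₁.ne hε')
  obtain ⟨π₂, h₂, hl₂⟩ := exists_isCoupling_of_wasserstein2_lt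
    (ENNReal.lt_add_right hf₂.ne hε')
  obtain ⟨τ, ht₁, ht₂⟩ := exists_gluing h₁ h₂
  have hm₁ : Measurable fun q : α × α × α => (q.2.1, q.1) := by fun_prop
  have hm₂ : Measurable fun q : α × α × α => (q.1, q.2.2) := by fun_prop
  have hm : Measurable fun q : α × α × α => q.2 := by fun_prop
  have hd : Measurable fun q : α × α => edist q.1 q.2 := measurable_edist
  have hd2 : Measurable fun q : α × α => edist q.1 q.2 ^ 2 := hd.pow_const 2
  have hcoup : IsCoupling (τ.map fun q => q.2) μ ν := by
    constructor
    · rw [← h₁.1, ← ht₁, Measure.map_map measurable_fst hm,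
        Measure.map_map measurable_fst hm₁]; rfl
    · rw [← h₂.2, ← ht₂, Measure.map_map measurable_snd hm,
        Measure.map_map measurable_snd hm₂]; rfl
  have hmink := ENNReal.lintegral_Lp_add_le (μ := τ) (p := 2)
    (hd.comp hm₁).aemeasurable (hd.comp hm₂).aemeasurable (by norm_num)
  calc W2 μ ν ≤ (∫⁻ q, edist q.1 q.2 ^ 2 ∂(τ.map fun q => q.2)) ^ (1 / 2 : ℝ) :=
        wasserstein2_le_of_isCoupling hcoup
    _ = (∫⁻ q, edist q.2.1 q.2.2 ^ 2 ∂τ) ^ (1 / 2 : ℝ) := by rw [lintegral_map hd2 hm]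
    _ ≤ (∫⁻ q, (edist q.2.1 q.1 + edist q.1 q.2.2) ^ 2 ∂τ) ^ (1 / 2 : ℝ) := by
        gcongr; exact edist_triangle _ _ _
    _ ≤ (∫⁻ q, edist q.2.1 q.1 ^ 2 ∂τ) ^ (1 / 2 : ℝ)
        + (∫⁻ q, edist q.1 q.2.2 ^ 2 ∂τ) ^ (1 / 2 : ℝ) := by
        simpa [Function.comp_def] using hmink
    _ = (∫⁻ q, edist q.1 q.2 ^ 2 ∂π₁) ^ (1 / 2 : ℝ)
        + (∫⁻ q, edist q.1 q.2 ^ 2 ∂π₂) ^ (1 / 2 : ℝ) := by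
        rw [← ht₁, ← ht₂, lintegral_map hd2 hm₁, lintegral_map hd2 hm₂]
    _ ≤ (W2 μ ρ + (ε / 2 : ℝ≥0)) + (W2 ρ ν + (ε / 2 : ℝ≥0)) := add_le_add hl₁.le hl₂.le
    _ = W2 μ ρ + W2 ρ ν + ε := by
        rw [add_add_add_comm, ← ENNReal.coe_add, add_halves]

theorem tendsto_W2_right [OpensMeasurableSpace α] [SecondCountableTopology α]
    [StandardBorelSpace α] {ι : Type*} {l : Filter ι}
    (ξ : Measure α) {μ : ι → Measure α} {ν : Measure α} [∀ i, IsProbabilityMeasure (μ i)]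
    [IsProbabilityMeasure ν] (h : Tendsto (fun i => W2 (μ i) ν) l (nhds 0)) :
    Tendsto (fun i => W2 ξ (μ i)) l (nhds (W2 ξ ν)) := by
  refine tendsto_of_tendsto_of_tendsto_of_le_of_le (g := fun i => W2 ξ ν - W2 (μ i) ν)
    (h := fun i => W2 ξ ν + W2 (μ i) ν) ?_ ?_ (fun i => ?_) (fun i => ?_)
  · simpa using ENNReal.Tendsto.sub (tendsto_const_nhds (x := W2 ξ ν)) h (Or.inr (by simp))
  · simpa using (tendsto_const_nhds (x := W2 ξ ν)).add h
  · exact tsub_le_iff_right.2 (W2_triangle _ _ _)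
  · simp only [W2_comm (μ i) ν]
    exact W2_triangle _ _ _

end Triangle

section Quantization

/-- The finitely supported measure with weights `a` on the points `y`. -/
def atomicMeasure {α ι : Type*} [MeasurableSpace α] (y : ι → α) (a : ι → ℝ≥0∞) : Measure α :=
  Measure.sum fun i => a i • Measure.dirac (y i)

theorem sum_min_add_atomicMeasure {α ι : Type*} [MeasurableSpace α] (y : ι → α) (a b : ι → ℝ≥0∞) :
    atomicMeasure y (fun i => min (a i) (b i)) + atomicMeasure y (fun i => a i - b i) =
      atomicMeasure y a := by
  simp only [atomicMeasure, Measure.sum_add_sum, ← add_smul]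
  congr! 3 with i
  rw [add_comm, tsub_add_min]

variable {α ι : Type*} [MeasurableSpace α] [Fintype ι]

theorem atomicMeasure_univ (y : ι → α) (a : ι → ℝ≥0∞) : atomicMeasure y a univ = ∑ i, a i := by
  simp [atomicMeasure]

theorem lintegral_atomicMeasure (y : ι → α) (a : ι → ℝ≥0∞) {f : α → ℝ≥0∞} (hf : Measurable f) :
    ∫⁻ x, f x ∂(atomicMeasure y a) = ∑ i, a i * f (y i) := by
  simp [atomicMeasure, lintegral_dirac' _ hf]

theorem sum_tsub_comm_of_sum_eq_one {a b : ι → ℝ≥0∞} (ha : ∑ i, a i = 1) (hb : ∑ i, b i = 1) :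
    ∑ i, (a i - b i) = ∑ i, (b i - a i) := by
  have h₁ : ∑ i, min (a i) (b i) + ∑ i, (a i - b i) = 1 := by
    rw [← Finset.sum_add_distrib, ← ha]
    exact Finset.sum_congr rfl fun i _ => by rw [add_comm, tsub_add_min]
  have h₂ : ∑ i, min (a i) (b i) + ∑ i, (b i - a i) = 1 := by
    rw [← Finset.sum_add_distrib, ← hb]
    exact Finset.sum_congr rfl fun i _ => by rw [add_comm, min_comm, tsub_add_min]
  have hne : ∑ i, min (a i) (b i) ≠ ⊤ :=
    ne_top_of_le_ne_top ENNReal.one_ne_top (h₁ ▸ le_self_add)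
  exact (ENNReal.add_right_inj hne).1 (h₁.trans h₂.symm)

theorem W2_atomicMeasure_le [PseudoEMetricSpace α] [OpensMeasurableSpace α]
    [SecondCountableTopology α] (y : ι → α) {a b : ι → ℝ≥0∞} (ha : ∑ i, a i = 1)
    (hb : ∑ i, b i = 1) :
    W2 (atomicMeasure y a) (atomicMeasure y b) ≤
      ((∑ i, (a i - b i)) * ∑ i, ∑ j, edist (y i) (y j) ^ 2) ^ (1 / 2 : ℝ) := by
  set r := ∑ i, (a i - b i) with hr
  set C := ∑ i, ∑ j, edist (y i) (y j) ^ 2 with hC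
  set A := atomicMeasure y (fun i => a i - b i) with hA
  set B := atomicMeasure y (fun i => b i - a i) with hB
  have hrB : r = ∑ i, (b i - a i) := sum_tsub_comm_of_sum_eq_one ha hb
  have hAu : A univ = r := atomicMeasure_univ _ _
  have hBu : B univ = r := (atomicMeasure_univ _ _).trans hrB.symm
  have hr_top : r ≠ ⊤ := ne_top_of_le_ne_top ENNReal.one_ne_top
    (ha ▸ Finset.sum_le_sum fun i _ => tsub_le_self)
  have : IsFiniteMeasure A := ⟨by rw [hAu]; exact hr_top.lt_top⟩
  have : IsFiniteMeasure B := ⟨by rw [hBu]; exact hr_top.lt_top⟩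
  have cancel : ∀ {M : Measure α}, M univ = r → r⁻¹ • r • M = M := fun {M} hM => by
    rcases eq_or_ne r 0 with h0 | h0
    · rw [h0, Measure.measure_univ_eq_zero] at hM
      simp [hM]
    · rw [smul_smul, ENNReal.inv_mul_cancel h0 hr_top, one_smul]
  have hd2 : Measurable fun q : α × α => edist q.1 q.2 ^ 2 := measurable_edist.pow_const 2
  have hcoup : IsCoupling (atomicMeasure (fun i => (y i, y i)) (fun i => min (a i) (b i)) +
      r⁻¹ • A.prod B) (atomicMeasure y a) (atomicMeasure y b) := by
    have hmap : ∀ {f : α × α → α}, Measurable f → (∀ x, f (x, x) = x) →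
        (atomicMeasure (fun i => (y i, y i)) (fun i => min (a i) (b i))).map f =
          atomicMeasure y (fun i => min (a i) (b i)) := fun {f} hf hfd => by
      simp_rw [atomicMeasure, Measure.map_sum hf.aemeasurable, Measure.map_smul,
        Measure.map_dirac' hf, hfd]
    constructor
    · rw [Measure.map_add _ _ measurable_fst, Measure.map_smul, hmap measurable_fst fun _ => rfl,
        Measure.map_fst_prod, hBu, cancel hAu, sum_min_add_atomicMeasure]
    · rw [Measure.map_add _ _ measurable_snd, Measure.map_smul, hmap measurable_snd fun _ => rfl,
        Measure.map_snd_prod, hAu, cancel hBu]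
      simp only [min_comm (a _)]
      rw [sum_min_add_atomicMeasure]
  refine (wasserstein2_le_of_isCoupling hcoup).trans (ENNReal.rpow_le_rpow ?_ (by norm_num))
  have hprod : ∫⁻ q, edist q.1 q.2 ^ 2 ∂(A.prod B) ≤ r * (r * C) := by
    rw [lintegral_prod _ hd2.aemeasurable, lintegral_atomicMeasure _ _ (by fun_prop), hr,
      Finset.sum_mul]
    refine Finset.sum_le_sum fun i _ => mul_le_mul_right ?_ _
    rw [lintegral_atomicMeasure _ _ (by fun_prop), ← hr, hrB, Finset.sum_mul]
    refine Finset.sum_le_sum fun j _ => mul_le_mul_right ?_ _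
    exact (Finset.single_le_sum (f := fun j => edist (y i) (y j) ^ 2) (fun _ _ => zero_le)
      (Finset.mem_univ j)).trans (Finset.single_le_sum
        (f := fun i => ∑ j, edist (y i) (y j) ^ 2) (fun _ _ => zero_le) (Finset.mem_univ i))
  rw [lintegral_add_measure, lintegral_smul_measure, lintegral_atomicMeasure _ _ hd2]
  simp only [edist_self, ne_eq, OfNat.ofNat_ne_zero, not_false_eq_true, zero_pow, mul_zero,
    Finset.sum_const_zero, zero_add, smul_eq_mul]
  calc r⁻¹ * _ ≤ r⁻¹ * (r * (r * C)) := by gcongr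
    _ = (r⁻¹ * r) * (r * C) := by ring
    _ ≤ 1 * (r * C) := by gcongr; exact ENNReal.inv_mul_le_one r
    _ = r * C := one_mul _

theorem tendsto_W2_atomicMeasure [PseudoMetricSpace α] [OpensMeasurableSpace α]
    [SecondCountableTopology α] (y : ι → α) {κ : Type*} {l : Filter κ} {a : κ → ι → ℝ≥0∞}
    {b : ι → ℝ≥0∞} (ha : ∀ k, ∑ i, a k i = 1) (hb : ∑ i, b i = 1)
    (h : ∀ i, Tendsto (fun k => a k i) l (nhds (b i))) :
    Tendsto (fun k => W2 (atomicMeasure y (a k)) (atomicMeasure y b)) l (nhds 0) := by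
  have hbt : ∀ i, b i ≠ ⊤ := fun i => ne_top_of_le_ne_top ENNReal.one_ne_top
    (hb ▸ Finset.single_le_sum (f := b) (fun _ _ => zero_le) (Finset.mem_univ i))
  have hr : Tendsto (fun k => ∑ i, (a k i - b i)) l (nhds 0) := by
    simpa using tendsto_finsetSum Finset.univ fun i _ =>
      ENNReal.Tendsto.sub (h i) (tendsto_const_nhds (x := b i)) (Or.inr (hbt i))
  have hC : ∑ i, ∑ j, edist (y i) (y j) ^ 2 ≠ ⊤ := by
    simp [ENNReal.sum_eq_top, edist_ne_top]
  refine tendsto_of_tendsto_of_tendsto_of_le_of_le tendsto_const_nhds ?_ (fun _ => zero_le)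
    fun k => W2_atomicMeasure_le y (ha k) hb
  have := (ENNReal.Tendsto.mul_const hr (Or.inr hC)).ennrpow_const (1 / 2)
  simpa using this

end Quantization

section Quantizer

universe u

variable {E : Type u} [NormedAddCommGroup E]

/-- A finite continuous partition of unity on `E` with a point attached to each of its members. -/
structure Quantizer (E : Type u) [TopologicalSpace E] where
  /-- The index set. -/
  ι : Type u
  /-- The index set is finite. -/
  fintype : Fintype ι
  /-- The point attached to an index. -/
  pt : ι → E
  /-- The members of the partition of unity. -/
  wt : ι → E → ℝ≥0
  continuous_wt : ∀ i, Continuous (wt i)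
  sum_wt : ∀ x, ∑ i, wt i x = 1

attribute [instance] Quantizer.fintype

namespace Quantizer

/-- The mean squared displacement of the point `x` when it is sent to the point of index `i` with
probability `wt i x`. -/
def cost (Q : Quantizer E) (x : E) : ℝ≥0 := ∑ i, Q.wt i x * nndist x (Q.pt i) ^ 2

theorem continuous_cost (Q : Quantizer E) : Continuous Q.cost :=
  continuous_finsetSum _ fun i _ =>
    (Q.continuous_wt i).mul ((continuous_id.nndist continuous_const).pow 2)

theorem exists_cost_le [ProperSpace E] {ε : ℝ≥0} (hε : 0 < ε) (R : ℝ≥0) :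
    ∃ Q : Quantizer E, (∀ x, ‖x‖₊ ≤ R → Q.cost x ≤ ε ^ 2) ∧
      ∀ x, Q.cost x ≤ ε ^ 2 + ‖x‖₊ ^ 2 := by
  obtain ⟨t, -, ht, hcov⟩ :=
    (isCompact_closedBall (0 : E) R).finite_cover_balls (NNReal.coe_pos.2 hε)
  have := ht.fintype
  let ψ : Option t → E → ℝ≥0 := fun i x => i.elim (‖x‖₊ - R) fun y => ε - nndist x y
  have hψ : ∀ i, Continuous (ψ i) := by
    rintro (_ | y)
    · exact continuous_nnnorm.sub continuous_const
    · exact continuous_const.sub (continuous_id.nndist continuous_const)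
  have hpos : ∀ x, ∑ i, ψ i x ≠ 0 := fun x h0 => by
    simp only [Finset.sum_eq_zero_iff, Finset.mem_univ, true_imp_iff] at h0
    have hx : ‖x‖₊ ≤ R := tsub_eq_zero_iff_le.1 (h0 none)
    obtain ⟨y, hy, hxy⟩ := mem_iUnion₂.1 (hcov (by simpa using! hx : x ∈ Metric.closedBall 0 R))
    have := tsub_eq_zero_iff_le.1 (h0 (some ⟨y, hy⟩))
    exact absurd (NNReal.coe_le_coe.2 this) (not_le.2 hxy)
  let Q : Quantizer E :=
    { ι := Option t
      fintype := inferInstance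
      pt := fun i => i.elim 0 fun y => y
      wt := fun i x => ψ i x / ∑ j, ψ j x
      continuous_wt := fun i => (hψ i).div (continuous_finsetSum _ fun j _ => hψ j) hpos
      sum_wt := fun x => by rw [← Finset.sum_div, div_self (hpos x)] }
  have key : ∀ x, Q.cost x ≤ Q.wt none x * ‖x‖₊ ^ 2 + ε ^ 2 := fun x => by
    have hterm : ∀ y : t, Q.wt (some y) x * nndist x y ^ 2 ≤ Q.wt (some y) x * ε ^ 2 := fun y => by
      rcases le_total ε (nndist x y) with h | h
      · have : Q.wt (some y) x = 0 := by
          change (ε - nndist x y) / _ = 0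
          rw [tsub_eq_zero_of_le h, zero_div]
        simp [this]
      · gcongr
    calc Q.cost x = Q.wt none x * nndist x 0 ^ 2 + ∑ y : t, Q.wt (some y) x * nndist x y ^ 2 :=
          Fintype.sum_option _
      _ ≤ Q.wt none x * ‖x‖₊ ^ 2 + ∑ y : t, Q.wt (some y) x * ε ^ 2 := by
          rw [nndist_zero_right]
          exact add_le_add le_rfl (Finset.sum_le_sum fun y _ => hterm y)
      _ ≤ Q.wt none x * ‖x‖₊ ^ 2 + 1 * ε ^ 2 := by
          rw [← Finset.sum_mul, ← Q.sum_wt x]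
          gcongr
          exact le_add_self.trans_eq (Fintype.sum_option fun i => Q.wt i x).symm
      _ = _ := by rw [one_mul]
  refine ⟨Q, fun x hx => ?_, fun x => ?_⟩
  · have : Q.wt none x = 0 := by
      change (‖x‖₊ - R) / _ = 0
      rw [tsub_eq_zero_of_le hx, zero_div]
    simpa [this] using key x
  · refine (key x).trans ?_
    rw [add_comm]
    gcongr
    refine mul_le_of_le_one_left' ?_
    rw [← Q.sum_wt x]
    exact Finset.single_le_sum (f := fun i => Q.wt i x) (fun _ _ => zero_le) (Finset.mem_univ _)

theorem exists_seq_tendsto_cost (E : Type u) [NormedAddCommGroup E] [ProperSpace E] :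
    ∃ Q : ℕ → Quantizer E, (∀ m x, (Q m).cost x ≤ 1 + ‖x‖₊ ^ 2) ∧
      ∀ x, Tendsto (fun m => (Q m).cost x) atTop (nhds 0) := by
  choose Q hQ₁ hQ₂ using fun m : ℕ => exists_cost_le (E := E) (ε := 1 / ((m : ℝ≥0) + 1))
    (by positivity) m
  have hε : Tendsto (fun m : ℕ => (1 / ((m : ℝ≥0) + 1)) ^ 2) atTop (nhds 0) := by
    simpa using (tendsto_one_div_add_atTop_nhds_zero_nat (𝕜 := ℝ≥0)).pow 2
  refine ⟨Q, fun m x => (hQ₂ m x).trans ?_, fun x => ?_⟩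
  · gcongr
    refine pow_le_one₀ zero_le ?_
    rw [div_le_one (by positivity)]
    exact le_add_self
  · refine tendsto_of_tendsto_of_tendsto_of_le_of_le' tendsto_const_nhds hε
      (Eventually.of_forall fun _ => zero_le) ?_
    obtain ⟨N, hN⟩ := exists_nat_ge ‖x‖₊
    filter_upwards [eventually_ge_atTop N] with m hm
    exact hQ₁ m x (hN.trans (by exact_mod_cast hm))

theorem sum_coe_wt (Q : Quantizer E) (x : E) : ∑ i, (Q.wt i x : ℝ≥0∞) = 1 := by
  exact_mod_cast congrArg ((↑) : ℝ≥0 → ℝ≥0∞) (Q.sum_wt x)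

variable [MeasurableSpace E] [BorelSpace E]

/-- The image of a measure under the quantizer. -/
def quantize (Q : Quantizer E) (μ : Measure E) : Measure E :=
  atomicMeasure Q.pt fun i => ∫⁻ x, Q.wt i x ∂μ

theorem measurable_wt (Q : Quantizer E) (i : Q.ι) : Measurable fun x => (Q.wt i x : ℝ≥0∞) :=
  (Q.continuous_wt i).measurable.coe_nnreal_ennreal

theorem sum_lintegral_wt (Q : Quantizer E) (μ : Measure E) [IsProbabilityMeasure μ] :
    ∑ i, ∫⁻ x, Q.wt i x ∂μ = 1 := by
  rw [← lintegral_finsetSum _ fun i _ => Q.measurable_wt i]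
  simp [sum_coe_wt]

instance (Q : Quantizer E) (μ : Measure E) [IsProbabilityMeasure μ] :
    IsProbabilityMeasure (Q.quantize μ) :=
  ⟨by rw [quantize, atomicMeasure_univ, sum_lintegral_wt]⟩

theorem W2_quantize_le [SecondCountableTopology E] (Q : Quantizer E) (μ : Measure E) :
    W2 μ (Q.quantize μ) ≤ (∫⁻ x, Q.cost x ∂μ) ^ (1 / 2 : ℝ) := by
  have hm : ∀ i, Measurable fun x : E => (x, Q.pt i) := fun i => by fun_prop
  have hcoup : IsCoupling (Measure.sum fun i =>
      (μ.withDensity fun x => Q.wt i x).map fun x => (x, Q.pt i)) μ (Q.quantize μ) := by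
    constructor
    · rw [Measure.map_sum measurable_fst.aemeasurable]
      simp_rw [Measure.map_map measurable_fst (hm _), Function.comp_def, Measure.map_id']
      rw [← withDensity_tsum fun i => Q.measurable_wt i, tsum_fintype]
      convert! withDensity_one
      ext x
      simp [sum_coe_wt]
    · rw [Measure.map_sum measurable_snd.aemeasurable]
      simp_rw [Measure.map_map measurable_snd (hm _), Function.comp_def, Measure.map_const]
      simp [quantize, atomicMeasure]
  refine (wasserstein2_le_of_isCoupling hcoup).trans (ENNReal.rpow_le_rpow ?_ (by norm_num))
  have hd2 : Measurable fun q : E × E => edist q.1 q.2 ^ 2 := measurable_edist.pow_const 2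
  rw [lintegral_sum_measure, tsum_fintype]
  have hterm : ∀ i, ∫⁻ q, edist q.1 q.2 ^ 2
      ∂((μ.withDensity fun x => Q.wt i x).map fun x => (x, Q.pt i)) =
      ∫⁻ x, Q.wt i x * edist x (Q.pt i) ^ 2 ∂μ := fun i => by
    rw [lintegral_map hd2 (hm i)]
    exact lintegral_withDensity_eq_lintegral_mul μ (Q.measurable_wt i) (hd2.comp (hm i))
  simp_rw [hterm]
  have hmeas : ∀ i, Measurable fun x => (Q.wt i x : ℝ≥0∞) * edist x (Q.pt i) ^ 2 :=
    fun i => (Q.measurable_wt i).mul (hd2.comp (hm i))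
  rw [← lintegral_finsetSum _ fun i _ => hmeas i]
  simp [cost]

theorem tendsto_lintegral_cost {Q : ℕ → Quantizer E}
    (hQ : ∀ m x, (Q m).cost x ≤ 1 + ‖x‖₊ ^ 2)
    (hQ₀ : ∀ x, Tendsto (fun m => (Q m).cost x) atTop (nhds 0)) {μ : Measure E} (hμ : MemP2 μ) :
    Tendsto (fun m => ∫⁻ x, (Q m).cost x ∂μ) atTop (nhds 0) := by
  have := hμ.1
  have h := tendsto_lintegral_of_dominated_convergence (μ := μ)
    (F := fun m x => ((Q m).cost x : ℝ≥0∞)) (f := fun _ => 0) (fun x => 1 + (‖x‖₊ : ℝ≥0∞) ^ 2)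
    (fun m => (Q m).continuous_cost.measurable.coe_nnreal_ennreal)
    (fun m => ae_of_all _ fun x => by simpa using ENNReal.coe_le_coe.2 (hQ m x))
    (by
      rw [lintegral_add_left measurable_const]
      simpa using hμ.2.ne)
    (ae_of_all _ fun x => ENNReal.tendsto_coe.2 (hQ₀ x))
  simpa using h

end Quantizer

end Quantizer

section Measurability

variable {E : Type*} [NormedAddCommGroup E] [MeasurableSpace E] [BorelSpace E]

theorem measurableSet_memP2 : MeasurableSet {μ : Measure E | MemP2 μ} := by
  have h₁ : Measurable fun μ : Measure E => μ univ := Measure.measurable_coe .univ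
  have h₂ : Measurable fun μ : Measure E => ∫⁻ x, (‖x‖₊ : ℝ≥0∞) ^ 2 ∂μ :=
    Measure.measurable_lintegral (by fun_prop)
  convert! (h₁ (measurableSet_singleton 1)).inter (h₂ measurableSet_Iio) using 1
  ext μ
  exact and_congr_left' ⟨fun h => h.measure_univ, fun h => ⟨h⟩⟩

variable [ProperSpace E]

theorem tendsto_W2_quantize {Q : ℕ → Quantizer E}
    (hQ : ∀ m x, (Q m).cost x ≤ 1 + ‖x‖₊ ^ 2)
    (hQ₀ : ∀ x, Tendsto (fun m => (Q m).cost x) atTop (nhds 0)) {μ : Measure E} (hμ : MemP2 μ) :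
    Tendsto (fun m => W2 ((Q m).quantize μ) μ) atTop (nhds 0) := by
  refine tendsto_of_tendsto_of_tendsto_of_le_of_le tendsto_const_nhds ?_ (fun _ => zero_le)
    fun m => (W2_comm _ _).trans_le ((Q m).W2_quantize_le μ)
  simpa using (Quantizer.tendsto_lintegral_cost hQ hQ₀ hμ).ennrpow_const (1 / 2)

theorem continuous_W2_atomicMeasure {ι : Type*} [Fintype ι] (y : ι → E) (ξ : Measure E) :
    Continuous fun a : {a : ι → ℝ≥0∞ // ∑ i, a i = 1} => W2 ξ (atomicMeasure y a.1) := by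
  have hprob : ∀ a : {a : ι → ℝ≥0∞ // ∑ i, a i = 1},
      IsProbabilityMeasure (atomicMeasure y a.1) := fun a =>
    ⟨by rw [atomicMeasure_univ]; exact a.2⟩
  refine continuous_iff_continuousAt.2 fun b => tendsto_W2_right ξ ?_
  refine tendsto_W2_atomicMeasure y (fun a => a.2) b.2 fun i => ?_
  exact ((continuous_apply i).comp continuous_subtype_val).tendsto b

theorem measurable_W2_quantize (Q : Quantizer E) (ξ : Measure E) :
    Measurable fun μ : {μ : Measure E // MemP2 μ} => W2 ξ (Q.quantize μ.1) := by
  have hsum : ∀ μ : {μ : Measure E // MemP2 μ}, ∑ i, ∫⁻ x, Q.wt i x ∂μ.1 = 1 := by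
    intro μ
    have := μ.2.1
    exact Q.sum_lintegral_wt μ.1
  have hcoord : Measurable fun μ : {μ : Measure E // MemP2 μ} =>
      (⟨fun i => ∫⁻ x, Q.wt i x ∂μ.1, hsum μ⟩ : {a : Q.ι → ℝ≥0∞ // ∑ i, a i = 1}) := by
    refine Measurable.subtype_mk ?_
    refine measurable_pi_lambda _ fun i => ?_
    exact (Measure.measurable_lintegral (Q.measurable_wt i)).comp measurable_subtype_coe
  have := (continuous_W2_atomicMeasure Q.pt ξ).measurable.comp hcoord
  exact this

theorem measurable_W2_memP2 (ξ : Measure E) :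
    Measurable fun μ : {μ : Measure E // MemP2 μ} => W2 ξ μ.1 := by
  obtain ⟨Q, hQ, hQ₀⟩ := Quantizer.exists_seq_tendsto_cost E
  refine measurable_of_tendsto_metrizable (fun m => measurable_W2_quantize (Q m) ξ)
    (tendsto_pi_nhds.2 fun μ => ?_)
  have := μ.2.1
  exact tendsto_W2_right ξ (tendsto_W2_quantize hQ hQ₀ μ.2)

theorem aemeasurable_W2 {Λ : Measure (Measure E)} (hΛ : ∀ᵐ μ ∂Λ, MemP2 μ) (ξ : Measure E) :
    AEMeasurable (fun μ => W2 ξ μ) Λ := by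
  rw [← Measure.restrict_eq_self_of_ae_mem (s := {μ | MemP2 μ}) hΛ]
  exact aemeasurable_restrict_of_measurable_subtype measurableSet_memP2 (measurable_W2_memP2 ξ)

end Measurability

section WeakConvergence

theorem ENNReal.tendsto_of_tendsto_add_of_le_liminf {ι : Type*} {l : Filter ι}
    {u v : ι → ℝ≥0∞} {a b : ℝ≥0∞} (h : Tendsto (fun i => u i + v i) l (nhds (a + b)))
    (hab : a + b ≠ ⊤) (hu : a ≤ liminf u l) (hv : b ≤ liminf v l) :
    Tendsto u l (nhds a) := by
  obtain ⟨ha, hb⟩ := ENNReal.add_ne_top.1 hab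
  refine tendsto_order.2 ⟨fun c hc => eventually_lt_of_lt_liminf (hc.trans_le hu), fun c hc => ?_⟩
  rcases eq_or_ne b 0 with rfl | hb0
  · rw [add_zero] at h
    exact (h.eventually_lt_const hc).mono fun i hi => le_self_add.trans_lt hi
  have hlt : a + b < c + b := ENNReal.add_lt_add_right hb hc
  have hcont : Tendsto (fun b' => c + b') (nhdsWithin b (Iio b)) (nhds (c + b)) :=
    ((continuous_const.add continuous_id).tendsto b).mono_left nhdsWithin_le_nhds
  have : (nhdsWithin b (Iio b)).NeBot := nhdsLT_neBot_of_exists_lt ⟨0, pos_iff_ne_zero.2 hb0⟩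
  obtain ⟨b', hb'c, hb'b⟩ :=
    ((hcont.eventually_const_lt hlt).and self_mem_nhdsWithin).exists
  filter_upwards [h.eventually_lt_const hb'c,
    eventually_lt_of_lt_liminf (lt_of_lt_of_le hb'b hv)] with i hi₁ hi₂
  by_contra! hi
  exact absurd hi₁ (not_lt.2 (add_le_add hi hi₂.le))

variable {X : Type*} [MeasurableSpace X] [TopologicalSpace X]

theorem lintegral_le_liminf_of_tendsto [OpensMeasurableSpace X] [HasOuterApproxClosed X]
    {P : ℕ → ProbabilityMeasure X} {P₀ : ProbabilityMeasure X} (hP : Tendsto P atTop (nhds P₀))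
    {f : X → ℝ≥0} (hf : Continuous f) :
    ∫⁻ x, f x ∂(P₀ : Measure X) ≤ liminf (fun k => ∫⁻ x, f x ∂(P k : Measure X)) atTop := by
  have := lintegral_le_liminf_lintegral_of_forall_isOpen_measure_le_liminf_measure
    (μ := (P₀ : Measure X)) (μs := fun k => (P k : Measure X)) (f := fun x => (f x : ℝ))
    (NNReal.continuous_coe.comp hf) (fun x => (f x).2)
    (fun G hG => ProbabilityMeasure.le_liminf_measure_open_of_tendsto hP hG)
  simpa using this

theorem tendsto_lintegral_of_le_of_tendsto [OpensMeasurableSpace X] [HasOuterApproxClosed X]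
    {P : ℕ → ProbabilityMeasure X} {P₀ : ProbabilityMeasure X} (hP : Tendsto P atTop (nhds P₀))
    {f g : X → ℝ≥0} (hf : Continuous f) (hg : Continuous g) (hfg : f ≤ g)
    (hg_fin : ∫⁻ x, g x ∂(P₀ : Measure X) ≠ ⊤)
    (hg_lim : Tendsto (fun k => ∫⁻ x, g x ∂(P k : Measure X)) atTop
      (nhds (∫⁻ x, g x ∂(P₀ : Measure X)))) :
    Tendsto (fun k => ∫⁻ x, f x ∂(P k : Measure X)) atTop
      (nhds (∫⁻ x, f x ∂(P₀ : Measure X))) := by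
  have hsplit : ∀ μ : Measure X, ∫⁻ x, g x ∂μ = ∫⁻ x, f x ∂μ + ∫⁻ x, (g x - f x : ℝ≥0) ∂μ :=
    fun μ => by
      rw [← lintegral_add_left hf.measurable.coe_nnreal_ennreal]
      refine lintegral_congr fun x => ?_
      rw [← ENNReal.coe_add, add_tsub_cancel_of_le (hfg x)]
  simp only [hsplit] at hg_fin hg_lim
  exact ENNReal.tendsto_of_tendsto_add_of_le_liminf hg_lim hg_fin
    (lintegral_le_liminf_of_tendsto hP hf) (lintegral_le_liminf_of_tendsto hP (hg.sub hf))

theorem exists_subseq_tendsto_of_lintegral_sq_le {X : Type*} [NormedAddCommGroup X]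
    [MeasurableSpace X] [BorelSpace X] [ProperSpace X] (P : ℕ → ProbabilityMeasure X)
    {M : ℝ≥0∞} (hM : M ≠ ⊤) (h : ∀ k, ∫⁻ x, (‖x‖₊ : ℝ≥0∞) ^ 2 ∂(P k : Measure X) ≤ M) :
    ∃ (P₀ : ProbabilityMeasure X) (φ : ℕ → ℕ), StrictMono φ ∧
      Tendsto (P ∘ φ) atTop (nhds P₀) := by
  have htight : IsTightMeasureSet {μ | ∃ p ∈ range P, (p : Measure X) = μ} := by
    refine isTightMeasureSet_iff_exists_isCompact_measure_compl_le.2 fun ε hε => ?_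
    obtain ⟨r, hr⟩ : ∃ r : ℕ, M / ε ≤ r := by
      rcases eq_or_ne ε 0 with h0 | h0
      · exact absurd h0 hε.ne'
      · obtain ⟨r, hr⟩ := ENNReal.exists_nat_gt (ENNReal.div_ne_top hM h0)
        exact ⟨r, hr.le⟩
    refine ⟨Metric.closedBall 0 (r + 1), isCompact_closedBall _ _, ?_⟩
    rintro _ ⟨_, ⟨k, rfl⟩, rfl⟩
    have hr0 : ((r : ℝ≥0∞) + 1) ≠ 0 := by positivity
    have hrt : ((r : ℝ≥0∞) + 1) ≠ ⊤ := by simp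
    calc (P k : Measure X) (Metric.closedBall 0 (r + 1))ᶜ
        ≤ (P k : Measure X) {x | (r + 1 : ℝ≥0∞) ≤ (‖x‖₊ : ℝ≥0∞) ^ 2} := by
          refine measure_mono fun x hx => ?_
          have hx' : (r + 1 : ℝ≥0) ≤ ‖x‖₊ := by
            have : (r + 1 : ℝ) < ‖x‖ := by simpa using hx
            exact_mod_cast this.le
          have h1 : (r + 1 : ℝ≥0) ≤ ‖x‖₊ ^ 2 := hx'.trans
            (le_self_pow (le_add_self.trans hx') two_ne_zero)
          show (r + 1 : ℝ≥0∞) ≤ (‖x‖₊ : ℝ≥0∞) ^ 2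
          exact_mod_cast h1
      _ ≤ (∫⁻ x, (‖x‖₊ : ℝ≥0∞) ^ 2 ∂(P k : Measure X)) / (r + 1) :=
          meas_ge_le_lintegral_div (by fun_prop) hr0 hrt
      _ ≤ M / (r + 1) := by gcongr; exact h k
      _ ≤ ε := by
          rw [ENNReal.div_le_iff hr0 hrt]
          rcases eq_or_ne ε ⊤ with rfl | hεt
          · simp
          · rw [mul_comm, ← ENNReal.div_le_iff hε.ne' hεt]
            exact hr.trans le_self_add
  obtain ⟨P₀, -, φ, hφ, hlim⟩ := (isCompact_closure_of_isTightMeasureSet htight).tendsto_subseq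
    fun k => subset_closure (mem_range_self k)
  exact ⟨P₀, φ, hφ, hlim⟩

end WeakConvergence

section SecondMoment

variable {E : Type*} [NormedAddCommGroup E]

theorem nnnorm_sq_le (x y : E) : ‖x‖₊ ^ 2 ≤ 2 * (nndist x y ^ 2 + ‖y‖₊ ^ 2) := by
  refine le_trans ?_ (add_sq_le (a := nndist x y) (b := ‖y‖₊))
  gcongr
  rw [nndist_eq_nnnorm]
  simpa using nnnorm_add_le (x - y) y

theorem coe_nnnorm_sq_le (x y : E) :
    (‖x‖₊ : ℝ≥0∞) ^ 2 ≤ 2 * (edist x y ^ 2 + (‖y‖₊ : ℝ≥0∞) ^ 2) := by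
  rw [edist_nndist]
  exact_mod_cast nnnorm_sq_le x y

variable [MeasurableSpace E]

theorem memP2_dirac_zero [BorelSpace E] : MemP2 (Measure.dirac (0 : E)) :=
  ⟨inferInstance, by rw [lintegral_dirac]; simp⟩

theorem W2_dirac_zero_le [BorelSpace E] [SecondCountableTopology E] (μ : Measure E)
    [IsProbabilityMeasure μ] :
    W2 μ (Measure.dirac 0) ≤ (∫⁻ x, (‖x‖₊ : ℝ≥0∞) ^ 2 ∂μ) ^ (1 / 2 : ℝ) := by
  have hm : Measurable fun x : E => (x, (0 : E)) := by fun_prop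
  have hcoup : IsCoupling (μ.map fun x => (x, (0 : E))) μ (Measure.dirac 0) := by
    constructor
    · rw [Measure.map_map measurable_fst hm]
      exact Measure.map_id
    · rw [Measure.map_map measurable_snd hm, Function.comp_def, Measure.map_const]
      simp
  refine (wasserstein2_le_of_isCoupling hcoup).trans
    (ENNReal.rpow_le_rpow ((lintegral_map_le _ _).trans ?_) (by norm_num))
  simp [enorm_eq_nnnorm]

variable [BorelSpace E]

theorem lintegral_sq_le_of_isCoupling [SecondCountableTopology E] {μ ν : Measure E}
    {π : Measure (E × E)} (h : IsCoupling π μ ν) :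
    ∫⁻ x, (‖x‖₊ : ℝ≥0∞) ^ 2 ∂μ ≤
      2 * (∫⁻ q, edist q.1 q.2 ^ 2 ∂π + ∫⁻ x, (‖x‖₊ : ℝ≥0∞) ^ 2 ∂ν) := by
  rw [← h.lintegral_fst (by fun_prop), ← h.lintegral_snd (by fun_prop),
    ← lintegral_add_right _ (by fun_prop), ← lintegral_const_mul' _ _ (by simp)]
  exact lintegral_mono fun q => coe_nnnorm_sq_le q.1 q.2

theorem lintegral_sq_le_W2 [SecondCountableTopology E] (μ : Measure E) :
    ∫⁻ x, (‖x‖₊ : ℝ≥0∞) ^ 2 ∂μ ≤ 2 * W2 μ (Measure.dirac 0) ^ 2 := by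
  have hmono : ∀ r, W2 μ (Measure.dirac 0) < r → ∫⁻ x, (‖x‖₊ : ℝ≥0∞) ^ 2 ∂μ ≤ 2 * r ^ 2 := by
    intro r hr
    obtain ⟨π, hπ, hlt⟩ := exists_isCoupling_of_wasserstein2_lt hr
    refine (lintegral_sq_le_of_isCoupling hπ).trans ?_
    rw [lintegral_dirac]
    gcongr
    simp only [nnnorm_zero, ENNReal.coe_zero, ne_eq, OfNat.ofNat_ne_zero, not_false_eq_true,
      zero_pow, add_zero]
    calc ∫⁻ q, edist q.1 q.2 ^ 2 ∂π
        = ((∫⁻ q, edist q.1 q.2 ^ 2 ∂π) ^ (1 / 2 : ℝ)) ^ 2 := by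
          rw [← ENNReal.rpow_natCast, ← ENNReal.rpow_mul]; simp
      _ ≤ r ^ 2 := by gcongr
  rcases eq_or_ne (W2 μ (Measure.dirac 0)) ⊤ with h | h
  · simp [h]
  · have : (nhdsWithin (W2 μ (Measure.dirac 0)) (Ioi (W2 μ (Measure.dirac 0)))).NeBot :=
      nhdsGT_neBot_of_exists_gt ⟨⊤, h.lt_top⟩
    have hcont : Tendsto (fun r : ℝ≥0∞ => 2 * r ^ 2)
        (nhdsWithin (W2 μ (Measure.dirac 0)) (Ioi (W2 μ (Measure.dirac 0))))
        (nhds (2 * W2 μ (Measure.dirac 0) ^ 2)) :=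
      (((ENNReal.continuous_const_mul (by simp)).comp (ENNReal.continuous_pow 2)).tendsto
        _).mono_left nhdsWithin_le_nhds
    exact ge_of_tendsto hcont (eventually_mem_nhdsWithin.mono fun r hr => hmono r hr)

theorem MemP2.of_W2_lt_top [SecondCountableTopology E] {μ ν : Measure E} (hμ : MemP2 μ)
    (h : W2 μ ν < ⊤) : MemP2 ν := by
  have := hμ.1
  rw [W2_comm] at h
  obtain ⟨π, hπ, hlt⟩ := exists_isCoupling_of_wasserstein2_lt h
  have hfin : ∫⁻ q, edist q.1 q.2 ^ 2 ∂π ≠ ⊤ := fun htop => by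
    rw [htop] at hlt
    simp at hlt
  refine ⟨⟨?_⟩, (lintegral_sq_le_of_isCoupling hπ).trans_lt ?_⟩
  · rw [← measure_univ (μ := μ), ← hπ.1, ← hπ.2, Measure.map_apply measurable_fst .univ,
      Measure.map_apply measurable_snd .univ, preimage_univ, preimage_univ]
  · exact ENNReal.mul_lt_top (by simp) (ENNReal.add_lt_top.2 ⟨hfin.lt_top, hμ.2⟩)

theorem MemP2.W2_lt_top [ProperSpace E] {μ ν : Measure E} (hμ : MemP2 μ) (hν : MemP2 ν) :
    W2 μ ν < ⊤ := by
  have := hμ.1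
  have := hν.1
  refine (W2_triangle μ (Measure.dirac 0) ν).trans_lt (ENNReal.add_lt_top.2 ⟨?_, ?_⟩)
  · exact (W2_dirac_zero_le μ).trans_lt (ENNReal.rpow_lt_top_of_nonneg (by norm_num) hμ.2.ne)
  · rw [W2_comm]
    exact (W2_dirac_zero_le ν).trans_lt (ENNReal.rpow_lt_top_of_nonneg (by norm_num) hν.2.ne)

end SecondMoment

section Convergence

variable {E : Type*} [NormedAddCommGroup E] [MeasurableSpace E] [BorelSpace E] [ProperSpace E]

theorem tendsto_W2_quantize_of_tendsto (Q : Quantizer E) {P : ℕ → ProbabilityMeasure E}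
    {P₀ : ProbabilityMeasure E} (hP : Tendsto P atTop (nhds P₀)) :
    Tendsto (fun k => W2 (Q.quantize (P k : Measure E)) (Q.quantize (P₀ : Measure E)))
      atTop (nhds 0) := by
  refine tendsto_W2_atomicMeasure Q.pt (fun k => Q.sum_lintegral_wt _) (Q.sum_lintegral_wt _)
    fun i => ?_
  refine tendsto_lintegral_of_le_of_tendsto hP (Q.continuous_wt i)
    (continuous_const (y := (1 : ℝ≥0))) (fun x => ?_) (by simp) (by simp)
  rw [← Q.sum_wt x]
  exact Finset.single_le_sum (f := fun i => Q.wt i x) (fun _ _ => zero_le) (Finset.mem_univ i)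

theorem tendsto_W2_of_tendsto_cost {P : ℕ → ProbabilityMeasure E} {P₀ : ProbabilityMeasure E}
    (hP : Tendsto P atTop (nhds P₀)) (hP₀ : MemP2 (P₀ : Measure E))
    (hcost : ∀ Q : Quantizer E, (∀ x, Q.cost x ≤ 1 + ‖x‖₊ ^ 2) →
      Tendsto (fun k => ∫⁻ x, Q.cost x ∂(P k : Measure E)) atTop
        (nhds (∫⁻ x, Q.cost x ∂(P₀ : Measure E)))) :
    Tendsto (fun k => W2 (P k : Measure E) (P₀ : Measure E)) atTop (nhds 0) := by
  obtain ⟨Q, hQ, hQ₀⟩ := Quantizer.exists_seq_tendsto_cost E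
  refine ENNReal.tendsto_nhds_zero.2 fun ε hε => ?_
  have hlim := (Quantizer.tendsto_lintegral_cost hQ hQ₀ hP₀).ennrpow_const (1 / 2)
  have hlim2 := hlim.add hlim
  rw [ENNReal.zero_rpow_of_pos (by norm_num), add_zero] at hlim2
  obtain ⟨m, hm⟩ := (hlim2.eventually_lt_const hε).exists
  have h := (((hcost (Q m) (hQ m)).ennrpow_const (1 / 2)).add
    (tendsto_W2_quantize_of_tendsto (Q m) hP)).add
      (tendsto_const_nhds (x := (∫⁻ x, (Q m).cost x ∂(P₀ : Measure E)) ^ (1 / 2 : ℝ)))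
  rw [add_zero] at h
  filter_upwards [h.eventually_lt_const hm] with k hk
  refine le_trans ?_ hk.le
  calc W2 (P k : Measure E) (P₀ : Measure E)
      ≤ W2 (P k : Measure E) ((Q m).quantize (P₀ : Measure E))
        + W2 ((Q m).quantize (P₀ : Measure E)) (P₀ : Measure E) := W2_triangle _ _ _
    _ ≤ (W2 (P k : Measure E) ((Q m).quantize (P k : Measure E))
        + W2 ((Q m).quantize (P k : Measure E)) ((Q m).quantize (P₀ : Measure E)))
        + W2 (P₀ : Measure E) ((Q m).quantize (P₀ : Measure E)) := by
        rw [W2_comm (P₀ : Measure E)]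
        gcongr
        exact W2_triangle _ _ _
    _ ≤ _ := by
        gcongr
        · exact (Q m).W2_quantize_le _
        · exact (Q m).W2_quantize_le _

theorem exists_subseq_tendsto_W2 {P : ℕ → ProbabilityMeasure E} {P₀ : ProbabilityMeasure E}
    (hP : Tendsto P atTop (nhds P₀)) (hP₀ : MemP2 (P₀ : Measure E)) {M : ℝ≥0∞} (hM : M ≠ ⊤)
    (hPM : ∀ k, ∫⁻ x, (‖x‖₊ : ℝ≥0∞) ^ 2 ∂(P k : Measure E) ≤ M) {ρ : Measure E} (hρ : MemP2 ρ)
    (hliminf : liminf (fun k => W2 (P k : Measure E) ρ) atTop ≤ W2 (P₀ : Measure E) ρ) :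
    ∃ φ : ℕ → ℕ, StrictMono φ ∧
      Tendsto (fun k => W2 (P (φ k) : Measure E) (P₀ : Measure E)) atTop (nhds 0) := by
  have := hρ.1
  set L := liminf (fun k => W2 (P k : Measure E) ρ) atTop with hL
  obtain ⟨x, hx, hx_top⟩ := exists_seq_tendsto_liminf (f := atTop)
    (u := fun k => W2 (P k : Measure E) ρ)
  rw [← hL] at hx
  have hL_top : L ≠ ⊤ := (hliminf.trans_lt (hP₀.W2_lt_top hρ)).ne
  have hfin : ∀ k, W2 (P k : Measure E) ρ ≠ ⊤ := fun k =>
    (MemP2.W2_lt_top ⟨inferInstance, (hPM k).trans_lt hM.lt_top⟩ hρ).ne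
  choose π hπ hlt using fun k : ℕ => exists_isCoupling_of_wasserstein2_lt
    (ENNReal.lt_add_right (hfin (x k)) (b := ((k : ℝ≥0∞) + 1)⁻¹) (by simp))
  let Γ : ℕ → ProbabilityMeasure (E × E) := fun k => ⟨π k, (hπ k).isProbabilityMeasure⟩
  obtain ⟨Γ₀, φ, hφ, hΓ⟩ := exists_subseq_tendsto_of_lintegral_sq_le Γ
    (M := M + ∫⁻ x, (‖x‖₊ : ℝ≥0∞) ^ 2 ∂ρ) (ENNReal.add_ne_top.2 ⟨hM, hρ.2.ne⟩) (fun k => by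
      calc ∫⁻ q, (‖q‖₊ : ℝ≥0∞) ^ 2 ∂(π k)
          ≤ ∫⁻ q, ((‖q.1‖₊ : ℝ≥0∞) ^ 2 + (‖q.2‖₊ : ℝ≥0∞) ^ 2) ∂(π k) := by
            refine lintegral_mono fun q => ?_
            rcases le_total ‖q.1‖₊ ‖q.2‖₊ with h | h
            · rw [Prod.nnnorm_def, max_eq_right h]; exact le_add_self
            · rw [Prod.nnnorm_def, max_eq_left h]; exact le_self_add
        _ = ∫⁻ x, (‖x‖₊ : ℝ≥0∞) ^ 2 ∂(P (x k) : Measure E) + ∫⁻ x, (‖x‖₊ : ℝ≥0∞) ^ 2 ∂ρ := by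
            rw [lintegral_add_left (by fun_prop), ← (hπ k).lintegral_fst (by fun_prop),
              ← (hπ k).lintegral_snd (by fun_prop)]
        _ ≤ _ := by gcongr; exact hPM _)
  have hxφ : Tendsto (x ∘ φ) atTop atTop := hx_top.comp hφ.tendsto_atTop
  have hPφ : Tendsto (fun k => P (x (φ k))) atTop (nhds P₀) := hP.comp hxφ
  have hΓ₀ : IsCoupling (Γ₀ : Measure (E × E)) (P₀ : Measure E) ρ := by
    constructor
    · have h := ProbabilityMeasure.tendsto_map_of_tendsto_of_continuous _ _ hΓ continuous_fst
      have h' := tendsto_nhds_unique (h.congr (f₂ := fun k => P (x (φ k)))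
        fun k => Subtype.ext (hπ (φ k)).1) hPφ
      exact congrArg Subtype.val h'
    · let R : ProbabilityMeasure E := ⟨ρ, hρ.1⟩
      have h := ProbabilityMeasure.tendsto_map_of_tendsto_of_continuous _ _ hΓ continuous_snd
      have h' := tendsto_nhds_unique
        (h.congr (f₂ := fun _ => R)
          fun k => Subtype.ext (hπ (φ k)).2)
        tendsto_const_nhds
      exact congrArg Subtype.val h'
  have hsqrt : Tendsto (fun k => (∫⁻ q, edist q.1 q.2 ^ 2 ∂(π (φ k))) ^ (1 / 2 : ℝ)) atTop
      (nhds L) := by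
    have hu : Tendsto (fun k => W2 (P (x k) : Measure E) ρ + ((k : ℝ≥0∞) + 1)⁻¹) atTop
        (nhds L) := by
      have h1 := (tendsto_add_atTop_iff_nat 1).2 ENNReal.tendsto_inv_nat_nhds_zero
      simpa using hx.add h1
    refine tendsto_of_tendsto_of_tendsto_of_le_of_le (hx.comp hφ.tendsto_atTop)
      (hu.comp hφ.tendsto_atTop) (fun k => ?_) (fun k => (hlt (φ k)).le)
    exact wasserstein2_le_of_isCoupling (hπ (φ k))
  have sq_sqrt : ∀ a : ℝ≥0∞, (a ^ (1 / 2 : ℝ)) ^ 2 = a := fun a => by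
    rw [← ENNReal.rpow_natCast, ← ENNReal.rpow_mul]; simp
  have hsq : Tendsto (fun k => ∫⁻ q, edist q.1 q.2 ^ 2 ∂(π (φ k))) atTop (nhds (L ^ 2)) := by
    have := ((ENNReal.continuous_pow 2).tendsto L).comp hsqrt
    simpa only [Function.comp_def, sq_sqrt] using this
  have hΓ₀L : ∫⁻ q, edist q.1 q.2 ^ 2 ∂(Γ₀ : Measure (E × E)) = L ^ 2 := by
    refine le_antisymm ?_ ?_
    · have h := lintegral_le_liminf_of_tendsto hΓ
        (f := fun q : E × E => nndist q.1 q.2 ^ 2) (by fun_prop)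
      simp only [ENNReal.coe_pow, ← edist_nndist] at h
      exact h.trans_eq hsq.liminf_eq
    · rw [← sq_sqrt (∫⁻ q, edist q.1 q.2 ^ 2 ∂(Γ₀ : Measure (E × E)))]
      gcongr
      exact hliminf.trans (wasserstein2_le_of_isCoupling hΓ₀)
  have hdom : ∀ {σ : Measure (E × E)} {μ : Measure E}, IsProbabilityMeasure σ →
      IsCoupling σ μ ρ →
      ∫⁻ q, (1 + 2 * (nndist q.1 q.2 ^ 2 + ‖q.2‖₊ ^ 2) : ℝ≥0) ∂σ =
        1 + 2 * (∫⁻ q, edist q.1 q.2 ^ 2 ∂σ + ∫⁻ x, (‖x‖₊ : ℝ≥0∞) ^ 2 ∂ρ) := by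
    intro σ μ _ hσ
    simp only [ENNReal.coe_add, ENNReal.coe_mul, ENNReal.coe_pow, ← edist_nndist,
      ENNReal.coe_one, ENNReal.coe_ofNat]
    rw [lintegral_add_left measurable_const, lintegral_const_mul' _ _ (by simp),
      lintegral_add_right _ (by fun_prop),
      hσ.lintegral_snd (f := fun x => (‖x‖₊ : ℝ≥0∞) ^ 2) (by fun_prop)]
    simp
  have hmain : Tendsto (fun k => W2 (P (x (φ k)) : Measure E) (P₀ : Measure E)) atTop
      (nhds 0) := by
    refine tendsto_W2_of_tendsto_cost hPφ hP₀ fun Q hQ => ?_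
    have hcm : Measurable fun x => (Q.cost x : ℝ≥0∞) :=
      Q.continuous_cost.measurable.coe_nnreal_ennreal
    have h := tendsto_lintegral_of_le_of_tendsto hΓ (f := fun q : E × E => Q.cost q.1)
      (g := fun q => 1 + 2 * (nndist q.1 q.2 ^ 2 + ‖q.2‖₊ ^ 2))
      (Q.continuous_cost.comp continuous_fst) (by fun_prop)
      (fun q => (hQ q.1).trans (add_le_add le_rfl (nnnorm_sq_le q.1 q.2))) ?_ ?_
    · rw [hΓ₀.lintegral_fst hcm.aemeasurable] at h
      exact h.congr fun k => (hπ (φ k)).lintegral_fst hcm.aemeasurable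
    · rw [hdom inferInstance hΓ₀, hΓ₀L]
      refine ENNReal.add_ne_top.2 ⟨by simp, ENNReal.mul_ne_top (by simp)
        (ENNReal.add_ne_top.2 ⟨by simpa using hL_top, hρ.2.ne⟩)⟩
    · rw [hdom inferInstance hΓ₀, hΓ₀L]
      refine Tendsto.congr (fun k => (hdom (hπ (φ k)).isProbabilityMeasure (hπ (φ k))).symm) ?_
      exact tendsto_const_nhds.add
        (ENNReal.Tendsto.const_mul (hsq.add tendsto_const_nhds) (Or.inr (by simp)))
  obtain ⟨ψ, hψ, hψm⟩ := strictMono_subseq_of_tendsto_atTop hxφ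
  exact ⟨_, hψm, hmain.comp hψ.tendsto_atTop⟩

end Convergence

section Median

variable {E : Type*} [NormedAddCommGroup E] [MeasurableSpace E] [BorelSpace E] [ProperSpace E]

theorem lintegral_W2_le_add {Λ₁ Λ₂ : Measure (Measure E)} [IsProbabilityMeasure Λ₁]
    (hΛ₂ : ∀ᵐ μ ∂Λ₂, MemP2 μ) (hΛ₁ : ∀ᵐ μ ∂Λ₁, MemP2 μ) (ξ : Measure E) :
    ∫⁻ μ, W2 ξ μ ∂Λ₁ ≤ ∫⁻ μ, W2 ξ μ ∂Λ₂ + wasserstein2 W2 Λ₁ Λ₂ := by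
  rcases eq_or_ne (∫⁻ μ, W2 ξ μ ∂Λ₂) ⊤ with h | h
  · simp [h]
  refine le_of_forall_gt fun r hr => ?_
  have hr' : wasserstein2 W2 Λ₁ Λ₂ < r - ∫⁻ μ, W2 ξ μ ∂Λ₂ :=
    lt_tsub_iff_left.2 hr
  obtain ⟨π, hπ, hlt⟩ := exists_isCoupling_of_wasserstein2_lt hr'
  have := hπ.isProbabilityMeasure
  have hsnd : ∀ᵐ q ∂π, MemP2 q.2 := by
    rw [← hπ.2] at hΛ₂
    exact ae_of_ae_map measurable_snd.aemeasurable hΛ₂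
  have hmeas : AEMeasurable (fun q : Measure E × Measure E => W2 ξ q.2) π := by
    have := aemeasurable_W2 hΛ₂ ξ
    rw [← hπ.2] at this
    exact this.comp_measurable measurable_snd
  rw [lt_tsub_iff_left] at hlt
  refine lt_of_le_of_lt ?_ hlt
  calc ∫⁻ μ, W2 ξ μ ∂Λ₁ = ∫⁻ q, W2 ξ q.1 ∂π := (hπ.lintegral_fst (aemeasurable_W2 hΛ₁ ξ)).symm
    _ ≤ ∫⁻ q, (W2 ξ q.2 + W2 q.1 q.2) ∂π := by
        refine lintegral_mono_ae (hsnd.mono fun q hq => ?_)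
        have := hq.1
        rw [W2_comm q.1]
        exact W2_triangle ξ q.2 q.1
    _ = ∫⁻ μ, W2 ξ μ ∂Λ₂ + ∫⁻ q, W2 q.1 q.2 ∂π := by
        rw [lintegral_add_left' hmeas, hπ.lintegral_snd (aemeasurable_W2 hΛ₂ ξ)]
    _ ≤ _ := by
        gcongr
        exact lintegral_le_rpow_lintegral_sq _

theorem lintegral_W2_le_W2_add (Λ : Measure (Measure E)) [IsProbabilityMeasure Λ]
    (ξ ρ : Measure E) [IsProbabilityMeasure ρ] :
    ∫⁻ μ, W2 ξ μ ∂Λ ≤ W2 ξ ρ + ∫⁻ μ, W2 ρ μ ∂Λ := by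
  calc ∫⁻ μ, W2 ξ μ ∂Λ ≤ ∫⁻ μ, (W2 ξ ρ + W2 ρ μ) ∂Λ := lintegral_mono fun μ => W2_triangle ξ ρ μ
    _ = _ := by rw [lintegral_add_left measurable_const]; simp

theorem W2_le_lintegral_add {Λ : Measure (Measure E)} [IsProbabilityMeasure Λ]
    (hΛ : ∀ᵐ μ ∂Λ, MemP2 μ) (ξ ρ : Measure E) :
    W2 ξ ρ ≤ ∫⁻ μ, W2 ξ μ ∂Λ + ∫⁻ μ, W2 ρ μ ∂Λ := by
  rw [← lintegral_add_left' (aemeasurable_W2 hΛ ξ)]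
  calc W2 ξ ρ = ∫⁻ _, W2 ξ ρ ∂Λ := by simp
    _ ≤ _ := by
      refine lintegral_mono_ae (hΛ.mono fun μ hμ => ?_)
      have := hμ.1
      rw [W2_comm ρ]
      exact W2_triangle ξ μ ρ

theorem lintegral_W2_lt_top {Λ : Measure (Measure E)} [IsProbabilityMeasure Λ]
    (hmom : ∫⁻ μ, W2 μ (Measure.dirac 0) ^ 2 ∂Λ < ⊤) {ξ : Measure E} (hξ : MemP2 ξ) :
    ∫⁻ μ, W2 ξ μ ∂Λ < ⊤ := by
  refine (lintegral_W2_le_W2_add Λ ξ (Measure.dirac 0)).trans_lt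
    (ENNReal.add_lt_top.2 ⟨hξ.W2_lt_top memP2_dirac_zero, ?_⟩)
  simp only [W2_comm (Measure.dirac (0 : E))]
  exact (lintegral_le_rpow_lintegral_sq _).trans_lt
    (ENNReal.rpow_lt_top_of_nonneg (by norm_num) hmom.ne)

/-- A bounded minimizing sequence of the median functional of `Λ` subconverges in `W2`. -/
theorem exists_subseq_tendsto_W2_of_lintegral_W2_le {Λ : Measure (Measure E)}
    [IsProbabilityMeasure Λ] (hΛ : ∀ᵐ μ ∂Λ, MemP2 μ)
    (hmom : ∫⁻ μ, W2 μ (Measure.dirac 0) ^ 2 ∂Λ < ⊤) {P : ℕ → ProbabilityMeasure E}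
    {M : ℝ≥0∞} (hM : M ≠ ⊤) (hPM : ∀ k, ∫⁻ x, (‖x‖₊ : ℝ≥0∞) ^ 2 ∂(P k : Measure E) ≤ M)
    {ε : ℕ → ℝ≥0∞} (hε : Tendsto ε atTop (nhds 0))
    (hmin : ∀ k ξ, MemP2 ξ → ∫⁻ μ, W2 (P k : Measure E) μ ∂Λ ≤ ∫⁻ μ, W2 ξ μ ∂Λ + ε k) :
    ∃ (ν : Measure E) (φ : ℕ → ℕ), StrictMono φ ∧
      Tendsto (fun k => W2 (P (φ k) : Measure E) ν) atTop (nhds 0) := by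
  obtain ⟨P₀, φ, hφ, hP⟩ := exists_subseq_tendsto_of_lintegral_sq_le P hM hPM
  have hP₀ : MemP2 (P₀ : Measure E) := by
    refine ⟨inferInstance, lt_of_le_of_lt ?_ hM.lt_top⟩
    have h := lintegral_le_liminf_of_tendsto hP (f := fun x : E => ‖x‖₊ ^ 2) (by fun_prop)
    simp only [ENNReal.coe_pow] at h
    refine h.trans ((liminf_le_liminf (.of_forall fun k => hPM (φ k))).trans_eq ?_)
    exact liminf_const M
  have hmeas : ∀ k, AEMeasurable (fun μ => W2 (P (φ k) : Measure E) μ) Λ := fun k =>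
    aemeasurable_W2 hΛ _
  have hmeas_liminf : AEMeasurable
      (fun μ => liminf (fun k => W2 (P (φ k) : Measure E) μ) atTop) Λ := by
    simp only [liminf_eq_iSup_iInf_of_nat']
    exact .iSup fun n => .iInf fun i => hmeas (i + n)
  have hfatou : ∫⁻ μ, liminf (fun k => W2 (P (φ k) : Measure E) μ) atTop ∂Λ ≤
      ∫⁻ μ, W2 (P₀ : Measure E) μ ∂Λ := by
    have hlim : Tendsto (fun k => ∫⁻ μ, W2 (P₀ : Measure E) μ ∂Λ + ε (φ k)) atTop
        (nhds (∫⁻ μ, W2 (P₀ : Measure E) μ ∂Λ)) := by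
      simpa using tendsto_const_nhds.add (hε.comp hφ.tendsto_atTop)
    refine (lintegral_liminf_le' hmeas).trans ((liminf_le_liminf
      (.of_forall fun k => hmin (φ k) P₀ hP₀)).trans_eq hlim.liminf_eq)
  obtain ⟨ρ, hρ, hle⟩ : ∃ ρ, MemP2 ρ ∧
      liminf (fun k => W2 (P (φ k) : Measure E) ρ) atTop ≤ W2 (P₀ : Measure E) ρ := by
    by_contra! hcon
    refine hfatou.not_gt (lintegral_strict_mono (IsProbabilityMeasure.ne_zero Λ)
      hmeas_liminf (lintegral_W2_lt_top hmom hP₀).ne (hΛ.mono hcon))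
  obtain ⟨ψ, hψ, hlim⟩ := exists_subseq_tendsto_W2 hP hP₀ hM (fun k => hPM (φ k)) hρ hle
  exact ⟨P₀, φ ∘ ψ, hφ.comp hψ, hlim⟩

end Median

/-- Consistency of Wasserstein medians.
If `Λⱼ` are probability measures on `(P₂(ℝᵈ), W₂)` admitting Wasserstein medians `νⱼ`,
and `W₂(Λⱼ, Λ) → 0` for some `Λ ∈ P₂(P₂(ℝᵈ))` (second-level Wasserstein distance, with
ground cost `W₂`), then `{νⱼ}` has a limit point, and every limit point is a
Wasserstein median of `Λ`. -/
theorem wasserstein_median_consistency {d : ℕ}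
    (Λj : ℕ → Measure (Measure (Rd d))) (Λ : Measure (Measure (Rd d)))
    (νj : ℕ → Measure (Rd d))
    (hΛj_prob : ∀ j, IsProbabilityMeasure (Λj j))
    (hΛj_supp : ∀ j, (Λj j) {μ : Measure (Rd d) | ¬ MemP2 μ} = 0)
    (hmed : ∀ j, IsWassersteinMedian (Λj j) (νj j))
    (hΛ_prob : IsProbabilityMeasure Λ)
    (hΛ_supp : Λ {μ : Measure (Rd d) | ¬ MemP2 μ} = 0)
    (hΛ_mom : ∫⁻ μ, W2 μ (Measure.dirac (0 : Rd d)) ^ 2 ∂Λ < ⊤)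
    (hconv : Tendsto (fun j => wasserstein2 W2 (Λj j) Λ) atTop (nhds 0)) :
    (∃ (ν : Measure (Rd d)) (φ : ℕ → ℕ), StrictMono φ ∧
        Tendsto (fun k => W2 (νj (φ k)) ν) atTop (nhds 0)) ∧
    ∀ (ν : Measure (Rd d)) (φ : ℕ → ℕ), StrictMono φ →
        Tendsto (fun k => W2 (νj (φ k)) ν) atTop (nhds 0) →
        IsWassersteinMedian Λ ν := by
  have hΛ : ∀ᵐ μ ∂Λ, MemP2 μ := ae_iff.2 hΛ_supp
  have hΛj : ∀ j, ∀ᵐ μ ∂(Λj j), MemP2 μ := fun j => ae_iff.2 (hΛj_supp j)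
  set ε : ℕ → ℝ≥0∞ := fun j => wasserstein2 W2 (Λj j) Λ
  have hε2 : Tendsto (fun j => ε j + ε j) atTop (nhds 0) := by simpa using hconv.add hconv
  have hmin : ∀ j ξ, MemP2 ξ →
      ∫⁻ μ, W2 (νj j) μ ∂Λ ≤ ∫⁻ μ, W2 ξ μ ∂Λ + (ε j + ε j) := fun j ξ hξ => by
    calc ∫⁻ μ, W2 (νj j) μ ∂Λ ≤ ∫⁻ μ, W2 (νj j) μ ∂(Λj j) + ε j := by
          rw [show ε j = wasserstein2 W2 Λ (Λj j) from wasserstein2_comm W2_comm _ _]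
          exact lintegral_W2_le_add (hΛj j) hΛ _
      _ ≤ ∫⁻ μ, W2 ξ μ ∂(Λj j) + ε j := add_le_add ((hmed j).2 ξ hξ) le_rfl
      _ ≤ (∫⁻ μ, W2 ξ μ ∂Λ + ε j) + ε j := by
          gcongr
          exact lintegral_W2_le_add hΛ (hΛj j) _
      _ = _ := add_assoc _ _ _
  constructor
  · set F₀ := ∫⁻ μ, W2 (Measure.dirac (0 : Rd d)) μ ∂Λ
    have hF₀ : F₀ ≠ ⊤ := (lintegral_W2_lt_top hΛ_mom memP2_dirac_zero).ne
    obtain ⟨N, hN⟩ := eventually_atTop.1 (hε2.eventually_le_const zero_lt_one)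
    have hprob : ∀ j, IsProbabilityMeasure (νj j) := fun j => (hmed j).1.1
    obtain ⟨ν, φ, hφ, hν⟩ := exists_subseq_tendsto_W2_of_lintegral_W2_le hΛ hΛ_mom
      (P := fun k => ⟨νj (k + N), hprob _⟩) (M := 2 * (F₀ + 1 + F₀) ^ 2)
      (ENNReal.mul_ne_top (by simp) (ENNReal.pow_ne_top (by simp [hF₀])))
      (fun k => (lintegral_sq_le_W2 _).trans <| by
        gcongr
        refine (W2_le_lintegral_add hΛ _ _).trans ?_
        gcongr
        refine (hmin _ _ memP2_dirac_zero).trans ?_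
        gcongr
        exact hN _ (Nat.le_add_left _ _))
      ((tendsto_add_atTop_iff_nat N).2 hε2) (fun k => hmin (k + N))
    exact ⟨ν, fun k => φ k + N, fun a b hab => Nat.add_lt_add_right (hφ hab) N, hν⟩
  · intro ν φ hφ hν
    obtain ⟨k, hk⟩ := (hν.eventually_lt_const ENNReal.zero_lt_top).exists
    refine ⟨(hmed (φ k)).1.of_W2_lt_top hk, fun ξ hξ => ?_⟩
    have hlim : Tendsto (fun k => W2 (νj (φ k)) ν +
        (∫⁻ μ, W2 ξ μ ∂Λ + (ε (φ k) + ε (φ k)))) atTop (nhds (∫⁻ μ, W2 ξ μ ∂Λ)) := by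
      simpa using hν.add (tendsto_const_nhds.add (hε2.comp hφ.tendsto_atTop))
    refine ge_of_tendsto' hlim fun k => ?_
    have := (hmed (φ k)).1.1
    refine (lintegral_W2_le_W2_add Λ ν (νj (φ k))).trans ?_
    rw [W2_comm ν]
    gcongr
    exact hmin _ ξ hξ
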